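/- arXiv:2505.15578 — 2 statements merged into one kernel-verified Lean document; each statement's English description precedes it below -/
import Mathlib

section
/- Let ν > 0, let a : ℝ → ℝ be smooth on [0,1], and let f : ℝ → ℝ be smooth on [0,1] with f(x) ≥ 0 for all x ∈ [0,1]. Assume: (i) there exist λ > 0 and a C² function φ with φ(x) > 0 for all x ∈ [0,1], φ'(0) = φ'(1) = 0, and −ν φ''(x) − a(x) φ(x) = −λ φ(x) for all x ∈ [0,1]; and (ii) there exists x₀ ∈ [0,1] with a(x₀) < 0. Then there exists exactly one C² function u on [0,1] such that u(x) > 0 for all x ∈ [0,1], u'(0) = u'(1) = 0, and −ν u''(x) + (1/2) u'(x)² = a(x) u(x) + f(x) for all x ∈ [0,1]. -/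
open Set

/-- `u` is C² on `[0,1]`, with first derivative `u'` and second derivative `u''`. -/
def C2On01 (u u' u'' : ℝ → ℝ) : Prop :=
  (∀ x ∈ Icc (0:ℝ) 1, HasDerivAt u (u' x) x) ∧
  (∀ x ∈ Icc (0:ℝ) 1, HasDerivAt u' (u'' x) x) ∧
  ContinuousOn u'' (Icc (0:ℝ) 1)

/-- `u` is a positive Neumann solution of `-ν u'' + (1/2)(u')² = a u + f` on `[0,1]`. -/
def PosSolF (ν : ℝ) (a f u u' u'' : ℝ → ℝ) : Prop :=
  C2On01 u u' u'' ∧ (∀ x ∈ Icc (0:ℝ) 1, 0 < u x) ∧ u' 0 = 0 ∧ u' 1 = 0 ∧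
  ∀ x ∈ Icc (0:ℝ) 1, -ν * u'' x + (1/2) * (u' x)^2 = a x * u x + f x

open scoped NNReal

/-- Neumann maximum principle: a function that is convex up to a positive weight wherever it is
positive, and whose outward derivatives are nonpositive, is either nonpositive or constant. -/
lemma nonpos_or_const_of_neumann {l p q b : ℝ → ℝ}
    (hl : ∀ x ∈ Icc (0:ℝ) 1, HasDerivAt l (p x) x)
    (hp : ∀ x ∈ Icc (0:ℝ) 1, HasDerivAt p (q x) x)
    (hb : ContinuousOn b (Icc (0:ℝ) 1))
    (hq : ∀ x ∈ Icc (0:ℝ) 1, 0 < l x → b x * p x ≤ q x)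
    (h0 : 0 ≤ p 0) (h1 : p 1 ≤ 0) :
    (∀ x ∈ Icc (0:ℝ) 1, l x ≤ 0) ∨ ∃ c > 0, ∀ x ∈ Icc (0:ℝ) 1, l x = c := by
  set b' : ℝ → ℝ := IccExtend zero_le_one ((Icc (0:ℝ) 1).domRestrict b) with hb'
  have hb'c : Continuous b' := hb.domRestrict.Icc_extend'
  have hb'e : ∀ x ∈ Icc (0:ℝ) 1, b' x = b x := fun x hx => by
    rw [hb', IccExtend_of_mem _ _ hx]; rfl
  set E : ℝ → ℝ := fun x => Real.exp (-∫ t in (0:ℝ)..x, b' t) with hE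
  have hEd : ∀ x, HasDerivAt E (-(E x * b' x)) x := fun x => by
    have h := (hb'c.integral_hasStrictDerivAt 0 x).hasDerivAt.neg.exp
    exact h.congr_deriv (mul_neg _ _)
  have hEpos : ∀ x, 0 < E x := fun x => Real.exp_pos _
  have hsq : ∀ y : ℝ, HasDerivAt (fun y : ℝ => (max y 0) ^ 2) (2 * max y 0) y := by
    intro y
    rcases lt_trichotomy y 0 with h | h | h
    · have : (fun y : ℝ => (max y 0) ^ 2) =ᶠ[nhds y] fun _ => 0 := by
        filter_upwards [Iio_mem_nhds h] with z hz
        simp [max_eq_right (le_of_lt (show z < 0 from hz))]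
      rw [max_eq_right h.le, mul_zero]
      exact (hasDerivAt_const y (0:ℝ)).congr_of_eventuallyEq this
    · subst h
      rw [hasDerivAt_iff_isLittleO]
      have h2 : (fun x : ℝ => x ^ 2) =o[nhds 0] fun x => x :=
        by simpa using (Asymptotics.isLittleO_pow_pow (𝕜 := ℝ) (show 1 < 2 by norm_num))
      have h3 : (fun x : ℝ => (max x 0) ^ 2) =O[nhds 0] fun x : ℝ => x ^ 2 := by
        refine Asymptotics.isBigO_of_le _ fun x => ?_
        rcases le_total x 0 with h | h
        · simp [max_eq_right h, sq_nonneg]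
        · simp [max_eq_left h]
      simpa using h3.trans_isLittleO h2
    · have : (fun y : ℝ => (max y 0) ^ 2) =ᶠ[nhds y] fun y => y ^ 2 := by
        filter_upwards [Ioi_mem_nhds h] with z hz
        simp [max_eq_left (le_of_lt (show 0 < z from hz))]
      rw [max_eq_left h.le]
      simpa using (hasDerivAt_pow 2 y).congr_of_eventuallyEq this
  set G : ℝ → ℝ := fun x => E x * p x * (max (l x) 0) ^ 2 with hG
  have hGd : ∀ x ∈ Icc (0:ℝ) 1, HasDerivAt G
      (E x * (q x - b x * p x) * (max (l x) 0) ^ 2 + E x * p x ^ 2 * (2 * max (l x) 0)) x := by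
    intro x hx
    have h := ((hEd x).mul (hp x hx)).mul ((hsq (l x)).comp x (hl x hx))
    refine h.congr_deriv ?_
    rw [hb'e x hx]; simp only [Pi.mul_apply, Function.comp]; ring
  have hGnn : ∀ x ∈ Icc (0:ℝ) 1,
      0 ≤ E x * (q x - b x * p x) * (max (l x) 0) ^ 2 + E x * p x ^ 2 * (2 * max (l x) 0) := by
    intro x hx
    rcases le_or_gt (l x) 0 with h | h
    · simp [max_eq_right h]
    · have := hq x hx h
      have := hEpos x
      rw [max_eq_left h.le]
      have : 0 ≤ q x - b x * p x := by linarith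
      positivity
  have hmono : MonotoneOn G (Icc 0 1) := by
    refine monotoneOn_of_deriv_nonneg (convex_Icc 0 1)
      (fun x hx => (hGd x hx).continuousAt.continuousWithinAt)
      (fun x hx => (hGd x (interior_subset hx)).differentiableAt.differentiableWithinAt)
      fun x hx => ?_
    rw [(hGd x (interior_subset hx)).deriv]
    exact hGnn x (interior_subset hx)
  have m0 : (0:ℝ) ∈ Icc (0:ℝ) 1 := by simp
  have m1 : (1:ℝ) ∈ Icc (0:ℝ) 1 := by simp
  have hG0 : 0 ≤ G 0 := mul_nonneg (mul_nonneg (hEpos 0).le h0) (sq_nonneg _)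
  have hG1 : G 1 ≤ 0 := mul_nonpos_of_nonpos_of_nonneg
    (mul_nonpos_of_nonneg_of_nonpos (hEpos 1).le h1) (sq_nonneg _)
  have hGz : ∀ x ∈ Icc (0:ℝ) 1, p x * max (l x) 0 = 0 := by
    intro x hx
    have e : G x = 0 := le_antisymm ((hmono hx m1 hx.2).trans hG1) (hG0.trans (hmono m0 hx hx.1))
    simp only [hG, mul_eq_zero, (hEpos x).ne', false_or, pow_eq_zero_iff two_ne_zero] at e
    simpa using e
  have hsc := constant_of_has_deriv_right_zero (a := (0:ℝ)) (b := 1)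
    (f := fun x => (max (l x) 0) ^ 2)
    (fun x hx => ((hsq (l x)).comp x (hl x hx)).continuousAt.continuousWithinAt)
    (fun x hx => by
      have hx := Ico_subset_Icc_self hx
      have h := (hsq (l x)).comp x (hl x hx)
      rw [show 2 * max (l x) 0 * p x = 0 by rw [mul_assoc, mul_comm _ (p x), hGz x hx, mul_zero]] at h
      exact h.hasDerivWithinAt)
  have hmc : ∀ x ∈ Icc (0:ℝ) 1, max (l x) 0 = max (l 0) 0 := fun x hx =>
    (pow_left_inj₀ (le_max_right _ _) (le_max_right _ _) two_ne_zero).1 (hsc x hx)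
  rcases le_or_gt (l 0) 0 with h | h
  · left
    intro x hx
    have := hmc x hx
    rw [max_eq_right h] at this
    exact max_eq_right_iff.1 this
  · refine Or.inr ⟨l 0, h, fun x hx => ?_⟩
    have := hmc x hx
    rw [max_eq_left h.le] at this
    rcases le_total (l x) 0 with h' | h'
    · rw [max_eq_right h'] at this; linarith
    · rwa [max_eq_left h'] at this

/-- Solutions of `w'' = H(x, w)`, `w(0) = s`, `w'(0) = 0` on `[0,1]`, for `H` bounded and Lipschitz
in the second variable. -/
lemma exists_flow_second_order {H : ℝ → ℝ → ℝ} {K : ℝ≥0} {B S : ℝ}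
    (hHc : ∀ y, Continuous fun x => H x y) (hHl : ∀ x, LipschitzWith K (H x))
    (hHb : ∀ x y, |H x y| ≤ B) (hS : 0 ≤ S) :
    ∃ w p : ℝ → ℝ → ℝ, (∀ s ∈ Icc (-S) S, w s 0 = s ∧ p s 0 = 0 ∧ ∀ x ∈ Icc (0:ℝ) 1,
      HasDerivAt (w s) (p s x) x ∧ HasDerivAt (p s) (H x (w s x)) x ∧ |p s x| ≤ B) ∧
      ContinuousOn (fun s => p s 1) (Icc (-S) S) := by
  have hB : 0 ≤ B := (abs_nonneg _).trans (hHb 0 0)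
  set c : ℝ → ℝ := fun p => max (-B) (min B p) with hc
  have hcl : LipschitzWith 1 c := (LipschitzWith.id.const_min B).const_max (-B)
  have hcb : ∀ p, |c p| ≤ B := fun p => abs_le.2 ⟨le_max_left _ _,
    max_le (by linarith) (min_le_left _ _)⟩
  have hce : ∀ p, |p| ≤ B → c p = p := fun p hp => by
    rw [abs_le] at hp
    simp [hc, hp.1, hp.2]
  set F : ℝ → ℝ × ℝ → ℝ × ℝ := fun x z => (c z.2, H x z.1) with hF
  have h0 : (0:ℝ) ∈ Icc (-1:ℝ) 2 := by norm_num
  have hPL : IsPicardLindelof F (⟨0, h0⟩ : Icc (-1:ℝ) 2) (0 : ℝ × ℝ)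
      (B.toNNReal * 2 + S.toNNReal) S.toNNReal B.toNNReal (max 1 K) := by
    refine ⟨fun t _ => ?_, fun z _ => ?_, fun t _ z _ => ?_, ?_⟩
    · have h1 := hcl.comp (LipschitzWith.prod_snd (α := ℝ) (β := ℝ))
      have h2 := (hHl t).comp (LipschitzWith.prod_fst (α := ℝ) (β := ℝ))
      have := h1.prodMk h2
      simp only [mul_one] at this
      exact this.lipschitzOnWith
    · exact (continuous_const.prodMk (hHc z.1)).continuousOn
    · rw [Real.coe_toNNReal _ hB]
      exact max_le (hcb _) (hHb _ _)
    · norm_num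
  obtain ⟨α, hα, L', hL'⟩ := hPL.exists_forall_mem_closedBall_eq_hasDerivWithinAt_lipschitzOnWith
  have hmem : ∀ s ∈ Icc (-S) S, ((s, 0) : ℝ × ℝ) ∈ Metric.closedBall (0 : ℝ × ℝ) S.toNNReal := by
    intro s hs
    rw [mem_closedBall_zero_iff, Real.coe_toNNReal _ hS]
    simpa [Prod.norm_def, hS] using abs_le.2 hs
  refine ⟨fun s x => (α (s, 0) x).1, fun s x => (α (s, 0) x).2, fun s hs => ?_, ?_⟩
  · obtain ⟨hi, hd⟩ := hα _ (hmem s hs)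
    have hi' : α (s, 0) 0 = (s, 0) := hi
    have hd' : ∀ x ∈ Icc (0:ℝ) 1, HasDerivAt (α (s, 0)) (F x (α (s, 0) x)) x := fun x hx =>
      (hd x ⟨by linarith [hx.1], by linarith [hx.2]⟩).hasDerivAt
        (Icc_mem_nhds (by linarith [hx.1]) (by linarith [hx.2]))
    have hd2 : ∀ x ∈ Icc (0:ℝ) 1,
        HasDerivAt (fun x => (α (s, 0) x).2) (H x (α (s, 0) x).1) x := fun x hx =>
      (hd' x hx).snd
    have hpb : ∀ x ∈ Icc (0:ℝ) 1, |(α (s, 0) x).2| ≤ B := by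
      intro x hx
      have := norm_image_sub_le_of_norm_deriv_le_segment' (fun x hx => (hd2 x hx).hasDerivWithinAt)
        (fun x _ => hHb x _) x hx
      simp only [hi', sub_zero, Real.norm_eq_abs] at this
      nlinarith [hx.2, hx.1]
    refine ⟨by simp [hi'], by simp [hi'], fun x hx => ⟨?_, hd2 x hx, hpb x hx⟩⟩
    have := (hd' x hx).fst
    simp only [hF] at this
    rwa [hce _ (hpb x hx)] at this
  · have h1 := (hL' 1 (by norm_num)).continuousOn
    exact continuous_snd.comp_continuousOn
      (h1.comp (continuous_id.prodMk continuous_const).continuousOn hmem)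

/-- A Neumann solution of `w'' = H(x, w)` by shooting. -/
lemma exists_neumann_of_bounded {H : ℝ → ℝ → ℝ} {K : ℝ≥0} {B R : ℝ}
    (hHc : ∀ y, Continuous fun x => H x y) (hHl : ∀ x, LipschitzWith K (H x))
    (hHb : ∀ x y, |H x y| ≤ B) (hR : 0 ≤ R)
    (hpos : ∀ x y, R ≤ y → 0 < H x y) (hneg : ∀ x y, y ≤ -R → H x y < 0) :
    ∃ w p : ℝ → ℝ, (∀ x ∈ Icc (0:ℝ) 1, HasDerivAt w (p x) x) ∧
      (∀ x ∈ Icc (0:ℝ) 1, HasDerivAt p (H x (w x)) x) ∧ p 0 = 0 ∧ p 1 = 0 := by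
  have hB : 0 ≤ B := (abs_nonneg _).trans (hHb 0 0)
  obtain ⟨w, p, hwp, hc⟩ := exists_flow_second_order hHc hHl hHb (add_nonneg hR hB)
  have near : ∀ s ∈ Icc (-(R + B)) (R + B), ∀ x ∈ Icc (0:ℝ) 1, |w s x - s| ≤ B := by
    intro s hs x hx
    obtain ⟨hw0, -, hd⟩ := hwp s hs
    have := norm_image_sub_le_of_norm_deriv_le_segment'
      (fun x hx => (hd x hx).1.hasDerivWithinAt)
      (fun x hx => (hd x (Ico_subset_Icc_self hx)).2.2) x hx
    rw [hw0, Real.norm_eq_abs] at this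
    nlinarith [hx.2, hx.1]
  have mS : R + B ∈ Icc (-(R + B)) (R + B) := ⟨by linarith, le_rfl⟩
  have mS' : -(R + B) ∈ Icc (-(R + B)) (R + B) := ⟨le_rfl, by linarith⟩
  have m0 : (0:ℝ) ∈ Icc (0:ℝ) 1 := by simp
  have m1 : (1:ℝ) ∈ Icc (0:ℝ) 1 := by simp
  have htop : 0 ≤ p (R + B) 1 := by
    obtain ⟨-, hp0, hd⟩ := hwp _ mS
    have : MonotoneOn (p (R + B)) (Icc 0 1) := by
      refine monotoneOn_of_deriv_nonneg (convex_Icc 0 1)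
        (fun x hx => (hd x hx).2.1.continuousAt.continuousWithinAt)
        (fun x hx => (hd x (interior_subset hx)).2.1.differentiableAt.differentiableWithinAt)
        fun x hx => ?_
      rw [(hd x (interior_subset hx)).2.1.deriv]
      have := abs_le.1 (near _ mS x (interior_subset hx))
      exact (hpos x _ (by linarith)).le
    rw [← hp0]; exact this m0 m1 zero_le_one
  have hbot : p (-(R + B)) 1 ≤ 0 := by
    obtain ⟨-, hp0, hd⟩ := hwp _ mS'
    have : AntitoneOn (p (-(R + B))) (Icc 0 1) := by
      refine antitoneOn_of_deriv_nonpos (convex_Icc 0 1)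
        (fun x hx => (hd x hx).2.1.continuousAt.continuousWithinAt)
        (fun x hx => (hd x (interior_subset hx)).2.1.differentiableAt.differentiableWithinAt)
        fun x hx => ?_
      rw [(hd x (interior_subset hx)).2.1.deriv]
      have := abs_le.1 (near _ mS' x (interior_subset hx))
      exact (hneg x _ (by linarith)).le
    rw [← hp0]; exact this m0 m1 zero_le_one
  obtain ⟨s, hs, hs1⟩ := intermediate_value_Icc (by linarith) hc ⟨hbot, htop⟩
  obtain ⟨-, hp0, hd⟩ := hwp s hs
  exact ⟨w s, p s, fun x hx => (hd x hx).1, fun x hx => (hd x hx).2.1, hp0, hs1⟩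

/-- The method of sub- and supersolutions for the Neumann problem `w'' = h(x, w)`. -/
lemma exists_neumann_between {h : ℝ → ℝ → ℝ} {K : ℝ≥0} {C m M : ℝ} {α α' α'' β β' β'' : ℝ → ℝ}
    (hhc : ContinuousOn (Function.uncurry h) (Icc 0 1 ×ˢ Icc m M))
    (hhl : ∀ x ∈ Icc (0:ℝ) 1, LipschitzOnWith K (h x) (Icc m M))
    (hhb : ∀ x ∈ Icc (0:ℝ) 1, ∀ y ∈ Icc m M, |h x y| ≤ C)
    (hm : ∀ x ∈ Icc (0:ℝ) 1, m ≤ α x) (hαβ : ∀ x ∈ Icc (0:ℝ) 1, α x ≤ β x)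
    (hM : ∀ x ∈ Icc (0:ℝ) 1, β x ≤ M)
    (hα : ∀ x ∈ Icc (0:ℝ) 1, HasDerivAt α (α' x) x)
    (hα' : ∀ x ∈ Icc (0:ℝ) 1, HasDerivAt α' (α'' x) x)
    (hα'' : ∀ x ∈ Icc (0:ℝ) 1, h x (α x) ≤ α'' x) (hα0 : 0 ≤ α' 0) (hα1 : α' 1 ≤ 0)
    (hβ : ∀ x ∈ Icc (0:ℝ) 1, HasDerivAt β (β' x) x)
    (hβ' : ∀ x ∈ Icc (0:ℝ) 1, HasDerivAt β' (β'' x) x)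
    (hβ'' : ∀ x ∈ Icc (0:ℝ) 1, β'' x ≤ h x (β x)) (hβ0 : β' 0 ≤ 0) (hβ1 : 0 ≤ β' 1) :
    ∃ w p : ℝ → ℝ, (∀ x ∈ Icc (0:ℝ) 1, HasDerivAt w (p x) x) ∧
      (∀ x ∈ Icc (0:ℝ) 1, HasDerivAt p (h x (w x)) x) ∧ p 0 = 0 ∧ p 1 = 0 ∧
      ∀ x ∈ Icc (0:ℝ) 1, α x ≤ w x ∧ w x ≤ β x := by
  have m0 : (0:ℝ) ∈ Icc (0:ℝ) 1 := by simp
  have hC : 0 ≤ C :=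
    (abs_nonneg _).trans (hhb 0 m0 (α 0) ⟨hm 0 m0, (hαβ 0 m0).trans (hM 0 m0)⟩)
  set π : ℝ → ℝ := fun x => max 0 (min 1 x) with hπ
  have hπm : ∀ x, π x ∈ Icc (0:ℝ) 1 := fun x =>
    ⟨le_max_left _ _, max_le zero_le_one (min_le_left _ _)⟩
  have hπe : ∀ x ∈ Icc (0:ℝ) 1, π x = x := fun x hx => by simp [hπ, hx.1, hx.2]
  have hπc : Continuous π := by fun_prop
  have hαc : Continuous fun x => α (π x) :=
    continuous_iff_continuousAt.2 fun x =>
      ContinuousAt.comp (f := π) (hα _ (hπm x)).continuousAt hπc.continuousAt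
  have hβc : Continuous fun x => β (π x) :=
    continuous_iff_continuousAt.2 fun x =>
      ContinuousAt.comp (f := π) (hβ _ (hπm x)).continuousAt hπc.continuousAt
  set clip : ℝ → ℝ → ℝ := fun x y => max (α (π x)) (min (β (π x)) y) with hclip
  have hclipm : ∀ x y, clip x y ∈ Icc m M := fun x y =>
    ⟨(hm _ (hπm x)).trans (le_max_left _ _),
      (max_le (hαβ _ (hπm x)) (min_le_left _ _)).trans (hM _ (hπm x))⟩
  have hclipl : ∀ x, LipschitzWith 1 (clip x) := fun x =>
    (LipschitzWith.id.const_min _).const_max _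
  have hclipβ : ∀ x y, β (π x) ≤ y → clip x y = β (π x) := fun x y hy => by
    simp [hclip, hy, hαβ _ (hπm x)]
  have hclipα : ∀ x y, y ≤ α (π x) → clip x y = α (π x) := fun x y hy => by
    simp [hclip, hy]
  set T : ℝ → ℝ := fun z => max (-1) (min 1 z) with hT
  have hTl : LipschitzWith 1 T := (LipschitzWith.id.const_min _).const_max _
  have hTb : ∀ z, |T z| ≤ 1 := fun z => abs_le.2 ⟨le_max_left _ _,
    max_le (by norm_num) (min_le_left _ _)⟩
  have hTpos : ∀ z, 0 < z → 0 < T z := fun z hz => lt_max_of_lt_right (lt_min one_pos hz)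
  have hTneg : ∀ z, z < 0 → T z < 0 := fun z hz =>
    max_lt (by norm_num) ((min_le_right _ _).trans_lt hz)
  have hTone : ∀ z, 1 ≤ z → T z = 1 := fun z hz => by simp [hT, hz]
  have hTone' : ∀ z, z ≤ -1 → T z = -1 := fun z hz => by
    simp [hT, hz]
  set H : ℝ → ℝ → ℝ := fun x y => h (π x) (clip x y) + (C + 1) * T (y - clip x y) with hH
  have hHc : ∀ y, Continuous fun x => H x y := by
    intro y
    have h1 : Continuous fun x => clip x y := hαc.max (hβc.min continuous_const)
    have h2 : Continuous fun x => h (π x) (clip x y) :=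
      hhc.comp_continuous (hπc.prodMk h1) fun x => ⟨hπm x, hclipm x y⟩
    exact h2.add (continuous_const.mul (hTl.continuous.comp (continuous_const.sub h1)))
  have hHb : ∀ x y, |H x y| ≤ C + (C + 1) := by
    intro x y
    refine (abs_add_le _ _).trans (add_le_add (hhb _ (hπm x) _ (hclipm x y)) ?_)
    rw [abs_mul, abs_of_nonneg (by linarith : 0 ≤ C + 1)]
    exact mul_le_of_le_one_right (by linarith) (hTb _)
  have hHl : ∀ x, LipschitzWith (K + (C + 1).toNNReal * 2) (H x) := by
    intro x
    refine LipschitzWith.of_dist_le_mul fun y z => ?_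
    have e1 : |clip x y - clip x z| ≤ |y - z| := by
      simpa [Real.dist_eq] using (hclipl x).dist_le_mul y z
    have e2 : |h (π x) (clip x y) - h (π x) (clip x z)| ≤ K * |clip x y - clip x z| := by
      simpa [Real.dist_eq] using
        (hhl _ (hπm x)).dist_le_mul _ (hclipm x y) _ (hclipm x z)
    have e3 : |T (y - clip x y) - T (z - clip x z)| ≤ |(y - clip x y) - (z - clip x z)| := by
      have := hTl.dist_le_mul (y - clip x y) (z - clip x z)
      rwa [NNReal.coe_one, one_mul, Real.dist_eq, Real.dist_eq] at this
    have e4 : |(y - clip x y) - (z - clip x z)| ≤ 2 * |y - z| := by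
      rw [show (y - clip x y) - (z - clip x z) = (y - z) - (clip x y - clip x z) by ring]
      linarith [abs_sub (y - z) (clip x y - clip x z)]
    have e5 : (K : ℝ) * |clip x y - clip x z| ≤ K * |y - z| :=
      mul_le_mul_of_nonneg_left e1 K.coe_nonneg
    rw [Real.dist_eq, Real.dist_eq]
    push_cast
    rw [Real.coe_toNNReal _ (by linarith : 0 ≤ C + 1)]
    have : H x y - H x z = (h (π x) (clip x y) - h (π x) (clip x z)) +
        (C + 1) * (T (y - clip x y) - T (z - clip x z)) := by simp only [hH]; ring
    rw [this]
    refine (abs_add_le _ _).trans ?_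
    rw [abs_mul, abs_of_nonneg (by linarith : 0 ≤ C + 1)]
    have e6 := mul_le_mul_of_nonneg_left (e3.trans e4) (by linarith : 0 ≤ C + 1)
    linarith
  set R : ℝ := max |m| |M| + 1 with hR
  have hRM : M ≤ R - 1 := by
    have := (le_abs_self M).trans (le_max_right |m| |M|); linarith
  have hRm : -(R - 1) ≤ m := by
    have := (neg_abs_le m); have := le_max_left |m| |M|; linarith
  obtain ⟨w, p, hw, hp, hp0, hp1⟩ := exists_neumann_of_bounded (R := R) hHc hHl hHb
    (by positivity)
    (fun x y hy => by
      have e := hclipβ x y (by linarith [hM _ (hπm x)])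
      have := abs_le.1 (hhb _ (hπm x) _ (hclipm x y))
      simp only [hH]
      rw [hTone _ (by rw [e]; linarith [hM _ (hπm x)])]
      linarith)
    (fun x y hy => by
      have e := hclipα x y (by linarith [hm _ (hπm x)])
      have := abs_le.1 (hhb _ (hπm x) _ (hclipm x y))
      simp only [hH]
      rw [hTone' _ (by rw [e]; linarith [hm _ (hπm x)])]
      linarith)
  have strict : ∀ {d r q : ℝ → ℝ}, (∀ x ∈ Icc (0:ℝ) 1, HasDerivAt d (r x) x) →
      (∀ x ∈ Icc (0:ℝ) 1, HasDerivAt r (q x) x) → (∀ x ∈ Icc (0:ℝ) 1, 0 < d x → 0 < q x) →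
      0 ≤ r 0 → r 1 ≤ 0 → ∀ x ∈ Icc (0:ℝ) 1, d x ≤ 0 := by
    intro d r q hd hr hq hr0 hr1
    rcases nonpos_or_const_of_neumann (b := fun _ => 0) hd hr continuousOn_const
      (fun x hx hdx => by simpa using (hq x hx hdx).le) hr0 hr1 with h | ⟨c, hc, h⟩
    · exact h
    · exfalso
      have hmono : StrictMonoOn r (Icc 0 1) := by
        refine strictMonoOn_of_deriv_pos (convex_Icc 0 1)
          (fun x hx => (hr x hx).continuousAt.continuousWithinAt) fun x hx => ?_
        have hx := interior_subset hx
        rw [(hr x hx).deriv]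
        exact hq x hx (by rw [h x hx]; exact hc)
      have := hmono m0 (by simp : (1:ℝ) ∈ Icc (0:ℝ) 1) one_pos
      linarith
  have hle : ∀ x ∈ Icc (0:ℝ) 1, w x - β x ≤ 0 := by
    refine strict (fun x hx => (hw x hx).sub (hβ x hx)) (fun x hx => (hp x hx).sub (hβ' x hx))
      (fun x hx hd => ?_) (by linarith) (by linarith)
    have e := hclipβ x (w x) (by rw [hπe x hx]; linarith)
    have e2 := hTpos _ hd
    have e3 := hβ'' x hx
    simp only [hH, e, hπe x hx]
    nlinarith
  have hge : ∀ x ∈ Icc (0:ℝ) 1, α x - w x ≤ 0 := by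
    refine strict (fun x hx => (hα x hx).sub (hw x hx)) (fun x hx => (hα' x hx).sub (hp x hx))
      (fun x hx hd => ?_) (by linarith) (by linarith)
    have e := hclipα x (w x) (by rw [hπe x hx]; linarith)
    have e2 := hTneg (w x - α x) (by linarith)
    have e3 := hα'' x hx
    simp only [hH, e, hπe x hx]
    nlinarith
  have hmem : ∀ x ∈ Icc (0:ℝ) 1, α x ≤ w x ∧ w x ≤ β x := fun x hx =>
    ⟨by linarith [hge x hx], by linarith [hle x hx]⟩
  refine ⟨w, p, hw, fun x hx => ?_, hp0, hp1, hmem⟩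
  have := hp x hx
  have e : clip x (w x) = w x := by simp [hclip, hπe x hx, hmem x hx]
  have eT : T 0 = 0 := by simp [hT]
  simpa only [hH, e, sub_self, eT, mul_zero, add_zero, hπe x hx] using this

/-- The derivative of a function that is constant on `[0,1]` vanishes there. -/
lemma hasDerivAt_eq_zero_of_const_Icc {g g' : ℝ → ℝ} {c : ℝ}
    (hg : ∀ x ∈ Icc (0:ℝ) 1, HasDerivAt g (g' x) x) (hc : ∀ x ∈ Icc (0:ℝ) 1, g x = c) :
    ∀ x ∈ Icc (0:ℝ) 1, g' x = 0 := fun x hx =>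
  (uniqueDiffOn_Icc one_pos x hx).eq_deriv _ (hg x hx).hasDerivWithinAt
    ((hasDerivWithinAt_const x _ c).congr hc (hc x hx))

/-- Comparison of two positive Neumann solutions. -/
lemma PosSolF.le {ν : ℝ} (hν : 0 < ν) {a f : ℝ → ℝ} (hf : ∀ x ∈ Icc (0:ℝ) 1, 0 ≤ f x)
    (ha : ∃ x₀ ∈ Icc (0:ℝ) 1, a x₀ < 0) {u u' u'' v v' v'' : ℝ → ℝ}
    (hu : PosSolF ν a f u u' u'') (hv : PosSolF ν a f v v' v'') :
    ∀ x ∈ Icc (0:ℝ) 1, v x ≤ u x := by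
  obtain ⟨⟨u1, u2, -⟩, upos, u0, ue1, ueq⟩ := hu
  obtain ⟨⟨v1, v2, -⟩, vpos, v0, ve1, veq⟩ := hv
  set l : ℝ → ℝ := fun x => Real.log (v x) - Real.log (u x) with hl
  set p : ℝ → ℝ := fun x => v' x / v x - u' x / u x with hp
  set q : ℝ → ℝ := fun x => (v'' x * v x - v' x * v' x) / v x ^ 2 -
    (u'' x * u x - u' x * u' x) / u x ^ 2 with hq
  set b : ℝ → ℝ := fun x => (u x / (2 * ν) - 1) * (v' x / v x + u' x / u x) with hb
  have hld : ∀ x ∈ Icc (0:ℝ) 1, HasDerivAt l (p x) x := fun x hx =>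
    ((v1 x hx).log (vpos x hx).ne').sub ((u1 x hx).log (upos x hx).ne')
  have hpd : ∀ x ∈ Icc (0:ℝ) 1, HasDerivAt p (q x) x := fun x hx =>
    ((v2 x hx).div (v1 x hx) (vpos x hx).ne').sub ((u2 x hx).div (u1 x hx) (upos x hx).ne')
  have hbc : ContinuousOn b (Icc (0:ℝ) 1) := fun x hx =>
    ((((u1 x hx).continuousAt.div_const _).sub continuousAt_const).mul
      (((v2 x hx).continuousAt.div (v1 x hx).continuousAt (vpos x hx).ne').add
      ((u2 x hx).continuousAt.div (u1 x hx).continuousAt (upos x hx).ne'))).continuousWithinAt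
  have key : ∀ x ∈ Icc (0:ℝ) 1, 2 * ν * (q x - b x * p x) =
      (v x - u x) * ((v' x / v x) ^ 2 + 2 * f x / (u x * v x)) := by
    intro x hx
    have hvx := (vpos x hx).ne'
    have hux := (upos x hx).ne'
    have e1 : v'' x = ((1/2) * (v' x)^2 - a x * v x - f x) / ν := by
      have := veq x hx
      field_simp
      linarith
    have e2 : u'' x = ((1/2) * (u' x)^2 - a x * u x - f x) / ν := by
      have := ueq x hx
      field_simp
      linarith
    simp only [hq, hb, hp, e1, e2]
    field_simp
    ring
  have hlpos : ∀ x ∈ Icc (0:ℝ) 1, 0 < l x → u x < v x := fun x hx h =>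
    (Real.log_lt_log_iff (upos x hx) (vpos x hx)).1 (sub_pos.1 h)
  rcases nonpos_or_const_of_neumann hld hpd hbc (fun x hx h => by
      have h1 := hlpos x hx h
      have h2 : 0 ≤ 2 * ν * (q x - b x * p x) := by
        rw [key x hx]
        have := upos x hx
        have := vpos x hx
        have := hf x hx
        exact mul_nonneg (by linarith) (by positivity)
      have := nonneg_of_mul_nonneg_right h2 (by positivity)
      linarith) (by simp [hp, u0, v0]) (by simp [hp, ue1, ve1]) with h | ⟨c, hc, h⟩
  · exact fun x hx => (Real.log_le_log_iff (vpos x hx) (upos x hx)).1 (sub_nonpos.1 (h x hx))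
  · exfalso
    have p0 := hasDerivAt_eq_zero_of_const_Icc hld h
    have q0 := hasDerivAt_eq_zero_of_const_Icc hpd p0
    have hu'0 : ∀ x ∈ Icc (0:ℝ) 1, u' x = 0 ∧ f x = 0 := by
      intro x hx
      have h1 := hlpos x hx (by rw [h x hx]; exact hc)
      have hux := upos x hx
      have hvx := vpos x hx
      have hfx := hf x hx
      have hk := key x hx
      rw [q0 x hx, p0 x hx] at hk
      simp only [mul_zero, sub_zero, zero_eq_mul] at hk
      rcases hk with hk | hk
      · linarith
      · have n1 : 0 ≤ (v' x / v x) ^ 2 := sq_nonneg _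
        have n2 : 0 ≤ 2 * f x / (u x * v x) := by positivity
        have z1 : (v' x / v x) ^ 2 = 0 := by linarith
        have z2 : 2 * f x / (u x * v x) = 0 := by linarith
        have z3 : v' x / v x = 0 := by simpa using z1
        have z4 := p0 x hx
        simp only [hp, z3, zero_sub, neg_eq_zero, div_eq_zero_iff, hux.ne', or_false] at z4
        simp only [div_eq_zero_iff, mul_eq_zero, hux.ne', hvx.ne', or_false,
          OfNat.ofNat_ne_zero, false_or] at z2
        exact ⟨z4, z2⟩
    obtain ⟨x₀, hx₀, ha⟩ := ha
    have := ueq x₀ hx₀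
    rw [hasDerivAt_eq_zero_of_const_Icc u2 (fun x hx => (hu'0 x hx).1) x₀ hx₀, (hu'0 x₀ hx₀).1,
      (hu'0 x₀ hx₀).2] at this
    have := mul_neg_of_neg_of_pos ha (upos x₀ hx₀)
    linarith

/-- First and second derivative of the Hopf–Cole transform `exp (-U / (2ν))`. -/
lemma hasDerivAt_hopfCole {ν : ℝ} (hν : ν ≠ 0) {U U' U'' : ℝ → ℝ} {x : ℝ}
    (h1 : HasDerivAt U (U' x) x) (h2 : HasDerivAt U' (U'' x) x) :
    HasDerivAt (fun y => Real.exp (-U y / (2 * ν)))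
      (-U' x / (2 * ν) * Real.exp (-U x / (2 * ν))) x ∧
    HasDerivAt (fun y => -U' y / (2 * ν) * Real.exp (-U y / (2 * ν)))
      (Real.exp (-U x / (2 * ν)) / (2 * ν ^ 2) * (-ν * U'' x + (1/2) * (U' x) ^ 2)) x := by
  have e1 : HasDerivAt (fun y => Real.exp (-U y / (2 * ν)))
      (-U' x / (2 * ν) * Real.exp (-U x / (2 * ν))) x :=
    ((h1.fun_neg.div_const (2 * ν)).exp).congr_deriv (mul_comm _ _)
  refine ⟨e1, (((h2.fun_neg.div_const (2 * ν))).fun_mul e1).congr_deriv ?_⟩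
  field_simp

/-- `y ↦ y log y` is Lipschitz on `[m, 1]` for `m > 0`. -/
lemma abs_mul_log_sub_mul_log_le {m y z : ℝ} (hm : 0 < m) (hy : y ∈ Icc m 1)
    (hz : z ∈ Icc m 1) :
    |y * Real.log y - z * Real.log z| ≤ (1 + |Real.log m|) * |y - z| := by
  refine (convex_Icc m 1).norm_image_sub_le_of_norm_hasDerivWithin_le
    (f := fun y => y * Real.log y) (f' := fun y => Real.log y + 1)
    (fun x hx => (Real.hasDerivAt_mul_log (hm.trans_le hx.1).ne').hasDerivWithinAt)
    (fun x hx => ?_) hz hy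
  have h1 := Real.log_le_log hm hx.1
  have h2 := Real.log_nonpos (hm.le.trans hx.1) hx.2
  rw [Real.norm_eq_abs, abs_le]
  have := neg_abs_le (Real.log m)
  constructor <;> linarith

/-- A positive Neumann solution exists between a positive subsolution and a larger
supersolution. -/
lemma exists_posSolF_of_sub_super {ν : ℝ} (hν : 0 < ν) {a f : ℝ → ℝ}
    (ha : ContinuousOn a (Icc (0:ℝ) 1)) (hf : ContinuousOn f (Icc (0:ℝ) 1))
    {U U' U'' V V' V'' : ℝ → ℝ}
    (hU : ∀ x ∈ Icc (0:ℝ) 1, HasDerivAt U (U' x) x)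
    (hU' : ∀ x ∈ Icc (0:ℝ) 1, HasDerivAt U' (U'' x) x)
    (hU0 : U' 0 ≤ 0) (hU1 : 0 ≤ U' 1)
    (hU'' : ∀ x ∈ Icc (0:ℝ) 1, a x * U x + f x ≤ -ν * U'' x + (1/2) * (U' x) ^ 2)
    (hV : ∀ x ∈ Icc (0:ℝ) 1, HasDerivAt V (V' x) x)
    (hV' : ∀ x ∈ Icc (0:ℝ) 1, HasDerivAt V' (V'' x) x)
    (hV0 : 0 ≤ V' 0) (hV1 : V' 1 ≤ 0)
    (hV'' : ∀ x ∈ Icc (0:ℝ) 1, -ν * V'' x + (1/2) * (V' x) ^ 2 ≤ a x * V x + f x)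
    (hVpos : ∀ x ∈ Icc (0:ℝ) 1, 0 < V x) (hVU : ∀ x ∈ Icc (0:ℝ) 1, V x ≤ U x) :
    ∃ u u' u'' : ℝ → ℝ, PosSolF ν a f u u' u'' := by
  have hUc : ContinuousOn U (Icc 0 1) := fun x hx => (hU x hx).continuousAt.continuousWithinAt
  obtain ⟨A, hA⟩ := isCompact_Icc.exists_bound_of_continuousOn ha
  obtain ⟨F, hF⟩ := isCompact_Icc.exists_bound_of_continuousOn hf
  obtain ⟨D, hD⟩ := isCompact_Icc.exists_bound_of_continuousOn hUc
  have m0 : (0:ℝ) ∈ Icc (0:ℝ) 1 := by simp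
  have hA0 : 0 ≤ A := (norm_nonneg _).trans (hA 0 m0)
  have hF0 : 0 ≤ F := (norm_nonneg _).trans (hF 0 m0)
  set m : ℝ := Real.exp (-D / (2 * ν)) with hm
  have hmpos : 0 < m := Real.exp_pos _
  set h : ℝ → ℝ → ℝ := fun x y => y / (2 * ν ^ 2) * (a x * (-(2 * ν) * Real.log y) + f x) with hh
  have hexp : ∀ x z, h x (Real.exp (-z / (2 * ν))) =
      Real.exp (-z / (2 * ν)) / (2 * ν ^ 2) * (a x * z + f x) := by
    intro x z
    simp only [hh, Real.log_exp]
    congr 3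
    field_simp
  have hhc : ContinuousOn (Function.uncurry h) (Icc 0 1 ×ˢ Icc m 1) := by
    have c1 : ContinuousOn (fun z : ℝ × ℝ => a z.1) (Icc 0 1 ×ˢ Icc m 1) :=
      ha.comp continuousOn_fst fun z hz => hz.1
    have c2 : ContinuousOn (fun z : ℝ × ℝ => f z.1) (Icc 0 1 ×ˢ Icc m 1) :=
      hf.comp continuousOn_fst fun z hz => hz.1
    have c3 : ContinuousOn (fun z : ℝ × ℝ => Real.log z.2) (Icc 0 1 ×ˢ Icc m 1) :=
      continuousOn_snd.log fun z hz => (hmpos.trans_le hz.2.1).ne'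
    exact (continuousOn_snd.div_const _).mul ((c1.mul (continuousOn_const.mul c3)).add c2)
  obtain ⟨C, hC⟩ := (isCompact_Icc.prod isCompact_Icc).exists_bound_of_continuousOn hhc
  set K : ℝ := (2 * ν * A * (1 + |Real.log m|) + F) / (2 * ν ^ 2) with hK
  have hK0 : 0 ≤ K := by positivity
  have hhl : ∀ x ∈ Icc (0:ℝ) 1, LipschitzOnWith K.toNNReal (h x) (Icc m 1) := by
    intro x hx
    refine LipschitzOnWith.of_dist_le_mul fun y hy z hz => ?_
    rw [Real.dist_eq, Real.dist_eq, Real.coe_toNNReal _ hK0]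
    have e1 := abs_mul_log_sub_mul_log_le hmpos hy hz
    have e : h x y - h x z = (-(2 * ν) * a x * (y * Real.log y - z * Real.log z) +
        f x * (y - z)) / (2 * ν ^ 2) := by simp only [hh]; ring
    rw [e, hK, abs_div, abs_of_pos (by positivity : 0 < 2 * ν ^ 2), div_mul_eq_mul_div]
    gcongr
    refine (abs_add_le _ _).trans ?_
    rw [abs_mul, abs_mul, abs_mul, abs_neg, abs_of_pos (by positivity : 0 < 2 * ν), add_mul,
      mul_assoc (2 * ν * A)]
    have := hA x hx
    have := hF x hx
    rw [Real.norm_eq_abs] at *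
    gcongr
  have hlo : ∀ x ∈ Icc (0:ℝ) 1, m ≤ Real.exp (-U x / (2 * ν)) := fun x hx => by
    have := (le_abs_self _).trans (hD x hx)
    rw [hm]; gcongr
  have hup : ∀ x ∈ Icc (0:ℝ) 1, Real.exp (-V x / (2 * ν)) < 1 := fun x hx => by
    rw [Real.exp_lt_one_iff, neg_div, neg_lt_zero]
    exact div_pos (hVpos x hx) (by positivity)
  obtain ⟨w, p, hw, hp, hp0, hp1, hmem⟩ := exists_neumann_between (C := C) hhc hhl
    (fun x hx y hy => hC (x, y) ⟨hx, hy⟩) hlo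
    (fun x hx => by have := hVU x hx; gcongr) (fun x hx => (hup x hx).le)
    (fun x hx => (hasDerivAt_hopfCole hν.ne' (hU x hx) (hU' x hx)).1)
    (fun x hx => (hasDerivAt_hopfCole hν.ne' (hU x hx) (hU' x hx)).2)
    (fun x hx => by rw [hexp]; have := hU'' x hx; gcongr)
    (mul_nonneg (div_nonneg (by linarith) (by positivity)) (Real.exp_pos _).le)
    (mul_nonpos_of_nonpos_of_nonneg
      (div_nonpos_of_nonpos_of_nonneg (by linarith) (by positivity)) (Real.exp_pos _).le)
    (fun x hx => (hasDerivAt_hopfCole hν.ne' (hV x hx) (hV' x hx)).1)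
    (fun x hx => (hasDerivAt_hopfCole hν.ne' (hV x hx) (hV' x hx)).2)
    (fun x hx => by rw [hexp]; have := hV'' x hx; gcongr)
    (mul_nonpos_of_nonpos_of_nonneg
      (div_nonpos_of_nonpos_of_nonneg (by linarith) (by positivity)) (Real.exp_pos _).le)
    (mul_nonneg (div_nonneg (by linarith) (by positivity)) (Real.exp_pos _).le)
  have hwpos : ∀ x ∈ Icc (0:ℝ) 1, 0 < w x := fun x hx => (Real.exp_pos _).trans_le (hmem x hx).1
  have hwc : ContinuousOn w (Icc 0 1) := fun x hx => (hw x hx).continuousAt.continuousWithinAt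
  have hpc : ContinuousOn p (Icc 0 1) := fun x hx => (hp x hx).continuousAt.continuousWithinAt
  refine ⟨fun x => -(2 * ν) * Real.log (w x), fun x => -(2 * ν) * (p x / w x),
    fun x => -(2 * ν) * ((h x (w x) * w x - p x * p x) / w x ^ 2),
    ⟨fun x hx => ((hw x hx).log (hwpos x hx).ne').const_mul _,
      fun x hx => ((hp x hx).div (hw x hx) (hwpos x hx).ne').const_mul _, ?_⟩,
    fun x hx => ?_, by simp [hp0], by simp [hp1], fun x hx => ?_⟩
  · have hhw : ContinuousOn (fun x => h x (w x)) (Icc 0 1) :=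
      hhc.comp (continuousOn_id.prodMk hwc) fun x hx =>
        ⟨hx, (hlo x hx).trans (hmem x hx).1, (hmem x hx).2.trans (hup x hx).le⟩
    exact continuousOn_const.mul (((hhw.mul hwc).sub (hpc.mul hpc)).div (hwc.pow 2)
      fun x hx => (pow_pos (hwpos x hx) 2).ne')
  · have := Real.log_neg (hwpos x hx) ((hmem x hx).2.trans_lt (hup x hx))
    exact mul_pos_of_neg_of_neg (by linarith) this
  · have := (hwpos x hx).ne'
    simp only [hh]
    field_simp
    ring

/-- Existence of a supersolution bounded below by `1` when `a` is negative somewhere. -/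
lemma exists_supersolution {ν : ℝ} {a f : ℝ → ℝ}
    (ha : ContinuousOn a (Icc (0:ℝ) 1)) (hf : ContinuousOn f (Icc (0:ℝ) 1))
    (ha_neg : ∃ x₀ ∈ Icc (0:ℝ) 1, a x₀ < 0) :
    ∃ U U' U'' : ℝ → ℝ, (∀ x, HasDerivAt U (U' x) x) ∧ (∀ x, HasDerivAt U' (U'' x) x) ∧
      U' 0 ≤ 0 ∧ 0 ≤ U' 1 ∧ (∀ x, 1 ≤ U x) ∧
      ∀ x ∈ Icc (0:ℝ) 1, a x * U x + f x ≤ -ν * U'' x + (1/2) * (U' x) ^ 2 := by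
  obtain ⟨x₀, hx₀, hneg⟩ := ha_neg
  obtain ⟨A, hA⟩ := isCompact_Icc.exists_bound_of_continuousOn ha
  obtain ⟨F, hF⟩ := isCompact_Icc.exists_bound_of_continuousOn hf
  have hA0 : 0 ≤ A := (norm_nonneg _).trans (hA x₀ hx₀)
  set c : ℝ := -a x₀ / 2 with hc
  have hc0 : 0 < c := by rw [hc]; linarith
  obtain ⟨δ, hδ, hnear⟩ := Metric.continuousOn_iff.1 ha x₀ hx₀ c hc0
  set k : ℝ := max 1 ((2 * ν + 1) / c) with hk
  have hk1 : 1 ≤ k := le_max_left _ _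
  have hkc : 2 * ν + 1 ≤ c * k := by
    have : (2 * ν + 1) / c ≤ k := le_max_right _ _
    rwa [div_le_iff₀' hc0] at this
  set D : ℝ := 2 * ν + A * (k + 1) with hD
  set M : ℝ := max 1 (max F ((D + 1) / (2 * δ ^ 2))) with hM
  have hM1 : 1 ≤ M := le_max_left _ _
  have hMF : F ≤ M := (le_max_left _ _).trans (le_max_right _ _)
  have hMD : D + 1 ≤ 2 * δ ^ 2 * M := by
    have : (D + 1) / (2 * δ ^ 2) ≤ M := (le_max_right _ _).trans (le_max_right _ _)
    rwa [div_le_iff₀' (by positivity)] at this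
  refine ⟨fun x => M * (k + (x - x₀) ^ 2), fun x => M * (2 * (x - x₀)), fun _ => M * 2,
    fun x => ?_, fun x => ?_, ?_, ?_, fun x => ?_, fun x hx => ?_⟩
  · have := ((((hasDerivAt_id x).sub_const x₀).pow 2).const_add k).const_mul M
    simpa using this
  · have := (((hasDerivAt_id x).sub_const x₀).const_mul 2).const_mul M
    simpa using this
  · nlinarith [hx₀.1]
  · nlinarith [hx₀.2]
  · nlinarith [sq_nonneg (x - x₀)]
  · have hfx := (le_abs_self _).trans (hF x hx)
    have hsq : 0 ≤ (x - x₀) ^ 2 := sq_nonneg _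
    have hM0 : 0 ≤ M := by linarith
    rcases lt_or_ge |x - x₀| δ with hd | hd
    · have h1 := (abs_lt.1 (hnear x hx hd)).2
      have h2 : a x ≤ -c := by rw [hc] at h1 ⊢; linarith
      have h3 : 2 * ν + 1 ≤ -a x * (k + (x - x₀) ^ 2) := by
        have : c * k ≤ -a x * (k + (x - x₀) ^ 2) := by
          apply mul_le_mul <;> linarith
        linarith
      have h4 := mul_le_mul_of_nonneg_left h3 hM0
      have h5 := mul_nonneg (mul_nonneg hM0 hM0) hsq
      linarith
    · have h1 : δ ^ 2 ≤ (x - x₀) ^ 2 := by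
        rw [← sq_abs (x - x₀)]; gcongr
      have h2 : (x - x₀) ^ 2 ≤ 1 := by
        rw [sq_le_one_iff_abs_le_one, abs_le]
        constructor <;> linarith [hx.1, hx.2, hx₀.1, hx₀.2]
      have h3 : a x * (k + (x - x₀) ^ 2) ≤ A * (k + 1) := by
        have := (le_abs_self _).trans (hA x hx)
        apply mul_le_mul <;> linarith
      have h4 : D + 1 ≤ 2 * (x - x₀) ^ 2 * M := hMD.trans (by gcongr)
      have h5 := mul_le_mul_of_nonneg_left h4 hM0
      have h6 := mul_le_mul_of_nonneg_left h3 hM0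
      rw [hD] at h5
      linarith

/-- A small multiple of the principal eigenfunction is a subsolution. -/
lemma exists_small_subsolution {ν lam : ℝ} (hlam : 0 < lam) {a f φ φ' φ'' : ℝ → ℝ}
    (hf : ∀ x ∈ Icc (0:ℝ) 1, 0 ≤ f x) (hφ : C2On01 φ φ' φ'')
    (hφ_pos : ∀ x ∈ Icc (0:ℝ) 1, 0 < φ x)
    (hφ_eq : ∀ x ∈ Icc (0:ℝ) 1, -ν * φ'' x - a x * φ x = -lam * φ x) :
    ∃ ε > 0, ∀ x ∈ Icc (0:ℝ) 1, ε * φ x ≤ 1 ∧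
      -ν * (ε * φ'' x) + (1/2) * (ε * φ' x) ^ 2 ≤ a x * (ε * φ x) + f x := by
  have hc : ContinuousOn φ (Icc 0 1) := fun x hx => (hφ.1 x hx).continuousAt.continuousWithinAt
  have hc' : ContinuousOn φ' (Icc 0 1) := fun x hx =>
    (hφ.2.1 x hx).continuousAt.continuousWithinAt
  obtain ⟨P, hP⟩ := isCompact_Icc.exists_bound_of_continuousOn hc
  obtain ⟨Q, hQ⟩ := isCompact_Icc.exists_bound_of_continuousOn
    ((hc'.pow 2).div hc fun x hx => (hφ_pos x hx).ne')
  have m0 : (0:ℝ) ∈ Icc (0:ℝ) 1 := by simp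
  have hP0 : 0 ≤ P := (norm_nonneg _).trans (hP 0 m0)
  have hQ0 : 0 ≤ Q := (norm_nonneg _).trans (hQ 0 m0)
  set ε : ℝ := min (1 / (P + 1)) (2 * lam / (Q + 1)) with hε
  have hε0 : 0 < ε := lt_min (by positivity) (by positivity)
  have hεP : ε * (P + 1) ≤ 1 := by
    have : ε ≤ 1 / (P + 1) := min_le_left _ _
    rwa [le_div_iff₀ (by positivity)] at this
  have hεQ : ε * (Q + 1) ≤ 2 * lam := by
    have : ε ≤ 2 * lam / (Q + 1) := min_le_right _ _
    rwa [le_div_iff₀ (by positivity)] at this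
  refine ⟨ε, hε0, fun x hx => ⟨?_, ?_⟩⟩
  · have := mul_le_mul_of_nonneg_left ((le_abs_self _).trans (hP x hx)) hε0.le
    linarith
  · have hφx := hφ_pos x hx
    have h1 : φ' x ^ 2 ≤ Q * φ x := by
      have : φ' x ^ 2 / φ x ≤ Q := (le_abs_self _).trans (hQ x hx)
      rwa [div_le_iff₀ hφx] at this
    have h2 : ε * φ' x ^ 2 ≤ 2 * lam * φ x := by
      have h3 := mul_le_mul_of_nonneg_left h1 hε0.le
      have h4 := mul_le_mul_of_nonneg_right hεQ hφx.le
      have h5 := mul_pos hε0 hφx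
      linarith
    have h3 := mul_le_mul_of_nonneg_left h2 hε0.le
    have h4 : ε * (-ν * φ'' x - a x * φ x) = ε * (-lam * φ x) := by rw [hφ_eq x hx]
    have := hf x hx
    linarith

/-- Theorem 3.4: existence and uniqueness of a positive Neumann solution of
`-ν u'' + (1/2)(u')² = a u + f` with a nonnegative smooth source term `f`. -/
theorem stmt_9 (ν : ℝ) (hν : 0 < ν) (a f : ℝ → ℝ)
    (ha_smooth : ContDiffOn ℝ (⊤ : ℕ∞) a (Icc (0:ℝ) 1))
    (hf_smooth : ContDiffOn ℝ (⊤ : ℕ∞) f (Icc (0:ℝ) 1))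
    (hf_nonneg : ∀ x ∈ Icc (0:ℝ) 1, 0 ≤ f x)
    (lam : ℝ) (hlam : 0 < lam) (φ φ' φ'' : ℝ → ℝ)
    (hφ : C2On01 φ φ' φ'')
    (hφ_pos : ∀ x ∈ Icc (0:ℝ) 1, 0 < φ x)
    (hφ'0 : φ' 0 = 0) (hφ'1 : φ' 1 = 0)
    (hφ_eq : ∀ x ∈ Icc (0:ℝ) 1, -ν * φ'' x - a x * φ x = -lam * φ x)
    (ha_neg : ∃ x₀ ∈ Icc (0:ℝ) 1, a x₀ < 0) :
    ∃ u u' u'' : ℝ → ℝ, PosSolF ν a f u u' u'' ∧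
      ∀ v v' v'' : ℝ → ℝ, PosSolF ν a f v v' v'' → ∀ x ∈ Icc (0:ℝ) 1, v x = u x := by
  obtain ⟨U, U', U'', hU, hU', hU0, hU1, hU_one, hU''⟩ :=
    exists_supersolution ha_smooth.continuousOn hf_smooth.continuousOn ha_neg
  obtain ⟨ε, hε, hsub⟩ := exists_small_subsolution hlam hf_nonneg hφ hφ_pos hφ_eq
  obtain ⟨u, u', u'', hu⟩ := exists_posSolF_of_sub_super hν ha_smooth.continuousOn
    hf_smooth.continuousOn (fun x _ => hU x) (fun x _ => hU' x) hU0 hU1 hU''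
    (fun x hx => (hφ.1 x hx).const_mul ε) (fun x hx => (hφ.2.1 x hx).const_mul ε)
    (by simp [hφ'0]) (by simp [hφ'1]) (fun x hx => (hsub x hx).2)
    (fun x hx => mul_pos hε (hφ_pos x hx)) (fun x hx => (hsub x hx).1.trans (hU_one x))
  exact ⟨u, u', u'', hu, fun v v' v'' hv x hx =>
    le_antisymm (hu.le hν hf_nonneg ha_neg hv x hx) (hv.le hν hf_nonneg ha_neg hu x hx)⟩
end

section
/- Let ν > 0 and let a₁, a₂ : ℝ → ℝ be continuous on [0,1] with a₁(x) ≤ a₂(x) for all x ∈ [0,1], and assume a₁ takes both a positive and a negative value on [0,1]. Suppose u₁ and u₂ are C² functions on [0,1], each bounded below on [0,1] by a positive constant, with u₁'(0) = u₁'(1) = u₂'(0) = u₂'(1) = 0, satisfying −ν u₁''(x) + (1/2) u₁'(x)² = a₁(x) u₁(x) and −ν u₂''(x) + (1/2) u₂'(x)² = a₂(x) u₂(x) for all x ∈ [0,1]. Then u₁(x) ≤ u₂(x) for all x ∈ [0,1]. -/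
open Set

theorem hasDerivAt_max_zero_sq (y : ℝ) :
    HasDerivAt (fun t : ℝ => max t 0 ^ 2) (2 * max y 0) y := by
  rcases lt_trichotomy y 0 with hy | rfl | hy
  · rw [max_eq_right hy.le, mul_zero]
    refine (hasDerivAt_const y (0 : ℝ)).congr_of_eventuallyEq ?_
    filter_upwards [Iio_mem_nhds hy] with t ht
    simp [max_eq_right (le_of_lt (mem_Iio.mp ht))]
  · rw [max_self, mul_zero, hasDerivAt_iff_isLittleO]
    refine Asymptotics.IsBigO.trans_isLittleO (g := fun t : ℝ => t ^ 2) ?_ ?_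
    · refine Asymptotics.isBigO_of_le _ fun t => ?_
      rcases le_total t 0 with ht | ht <;> simp [ht, sq_nonneg]
    · simpa using Asymptotics.isLittleO_pow_id (𝕜 := ℝ) one_lt_two
  · rw [max_eq_left hy.le]
    refine HasDerivAt.congr_of_eventuallyEq (f := fun t : ℝ => t ^ 2)
      (by simpa using hasDerivAt_pow 2 y) ?_
    filter_upwards [Ioi_mem_nhds hy] with t ht
    rw [max_eq_left (le_of_lt (mem_Ioi.mp ht))]

/-- A function vanishing on a nontrivial closed interval has zero derivative there. -/
theorem HasDerivAt.eq_zero_of_eqOn_Icc {f : ℝ → ℝ} {f' a b x : ℝ} (hab : a < b)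
    (hf : HasDerivAt f f' x) (h : ∀ y ∈ Icc a b, f y = 0) (hx : x ∈ Icc a b) : f' = 0 :=
  (uniqueDiffOn_Icc hab x hx).eq_deriv _ hf.hasDerivWithinAt
    ((hasDerivWithinAt_const x (Icc a b) (0 : ℝ)).congr h (h x hx))

/-- An everywhere positive integrating factor for a coefficient continuous on `[a,b]`. -/
theorem exists_integrating_factor {c : ℝ → ℝ} {a b : ℝ} (hab : a ≤ b)
    (hc : ContinuousOn c (Icc a b)) :
    ∃ E : ℝ → ℝ, (∀ x, 0 < E x) ∧ ∀ x ∈ Icc a b, HasDerivAt E (-c x * E x) x := by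
  have hcont : Continuous (IccExtend hab ((Icc a b).domRestrict c)) :=
    (continuousOn_iff_continuous_domRestrict.mp hc).Icc_extend'
  refine ⟨fun x => Real.exp (-∫ t in a..x, IccExtend hab ((Icc a b).domRestrict c) t),
    fun x => Real.exp_pos _, fun x hx => ?_⟩
  have h := ((hcont.integral_hasStrictDerivAt a x).hasDerivAt.neg).exp
  rw [IccExtend_of_mem hab _ hx] at h
  exact h.congr_deriv (by rw [mul_comm]; rfl)

/-- Strong maximum principle for the Neumann problem: a subsolution of `z'' - c z' = 0` on the set
where `z` is nonnegative, positive at one point, is a positive constant. -/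
theorem pos_and_deriv_eq_zero_of_neumann_subsolution {z z' z'' c : ℝ → ℝ} {a b : ℝ} (hab : a ≤ b)
    (hz : ∀ x ∈ Icc a b, HasDerivAt z (z' x) x)
    (hz' : ∀ x ∈ Icc a b, HasDerivAt z' (z'' x) x)
    (hc : ContinuousOn c (Icc a b)) (ha : z' a = 0) (hb : z' b = 0)
    (hsub : ∀ x ∈ Icc a b, 0 ≤ z x → c x * z' x ≤ z'' x)
    {x₀ : ℝ} (hx₀ : x₀ ∈ Icc a b) (hpos : 0 < z x₀) :
    ∀ x ∈ Icc a b, 0 < z x ∧ z' x = 0 := by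
  obtain ⟨E, hEpos, hE⟩ := exists_integrating_factor hab hc
  have hm : ∀ x ∈ Icc a b,
      HasDerivAt (fun x => max (z x) 0 ^ 2) (2 * max (z x) 0 * z' x) x := fun x hx =>
    (hasDerivAt_max_zero_sq (z x)).comp x (hz x hx)
  have hφ : ∀ x ∈ Icc a b, HasDerivAt (fun x => E x * z' x * max (z x) 0 ^ 2)
      (E x * (z'' x - c x * z' x) * max (z x) 0 ^ 2 + 2 * E x * z' x ^ 2 * max (z x) 0) x := by
    intro x hx
    refine (((hE x hx).mul (hz' x hx)).mul (hm x hx)).congr_deriv ?_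
    rw [Pi.mul_apply]
    ring
  have hmono : MonotoneOn (fun x => E x * z' x * max (z x) 0 ^ 2) (Icc a b) := by
    refine monotoneOn_of_hasDerivWithinAt_nonneg (convex_Icc a b)
      (fun x hx => (hφ x hx).continuousAt.continuousWithinAt)
      (fun x hx => (hφ x (interior_subset hx)).hasDerivWithinAt) fun x hx => ?_
    have hE0 := hEpos x
    rcases le_total (z x) 0 with h | h
    · simp [max_eq_right h]
    · rw [max_eq_left h]
      have := sub_nonneg.mpr (hsub x (interior_subset hx) h)
      positivity
  have hφ0 : ∀ x ∈ Icc a b, E x * z' x * max (z x) 0 ^ 2 = 0 := by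
    intro x hx
    have h1 := hmono (left_mem_Icc.mpr hab) hx hx.1
    have h2 := hmono hx (right_mem_Icc.mpr hab) hx.2
    simp only [ha, hb, mul_zero, zero_mul] at h1 h2
    exact le_antisymm h2 h1
  have hzero : ∀ x ∈ Icc a b, 2 * max (z x) 0 * z' x = 0 := by
    intro x hx
    have := hφ0 x hx
    have hE0 := (hEpos x).ne'
    simp only [mul_eq_zero, hE0, false_or, pow_eq_zero_iff two_ne_zero] at this
    rcases this with h | h <;> simp [h]
  have hconst : ∀ x ∈ Icc a b, max (z x) 0 ^ 2 = max (z a) 0 ^ 2 :=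
    constant_of_has_deriv_right_zero
      (fun x hx => (hm x hx).continuousAt.continuousWithinAt) fun x hx => by
        have h := hm x (Ico_subset_Icc_self hx)
        rw [hzero x (Ico_subset_Icc_self hx)] at h
        exact h.hasDerivWithinAt
  intro x hx
  have hzx : 0 < z x := by
    by_contra! h
    have h1 := (hconst x hx).trans (hconst x₀ hx₀).symm
    rw [max_eq_right h, max_eq_left hpos.le] at h1
    have := pow_pos hpos 2
    linarith
  refine ⟨hzx, ?_⟩
  have := hzero x hx
  rw [max_eq_left hzx.le] at this
  simpa [hzx.ne'] using this

/-- Proposition 3.7: monotonicity of the positive Neumann solution of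
`-ν u'' + (1/2)(u')² = a u` with respect to the coefficient `a`. -/
theorem stmt_12 (ν : ℝ) (hν : 0 < ν) (a₁ a₂ : ℝ → ℝ)
    (ha₁_cont : ContinuousOn a₁ (Icc (0:ℝ) 1)) (ha₂_cont : ContinuousOn a₂ (Icc (0:ℝ) 1))
    (ha₁₂ : ∀ x ∈ Icc (0:ℝ) 1, a₁ x ≤ a₂ x)
    (ha₁_pos : ∃ x ∈ Icc (0:ℝ) 1, 0 < a₁ x)
    (ha₁_neg : ∃ x ∈ Icc (0:ℝ) 1, a₁ x < 0)
    (u₁ u₁' u₁'' u₂ u₂' u₂'' : ℝ → ℝ)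
    (hu₁ : C2On01 u₁ u₁' u₁'') (hu₂ : C2On01 u₂ u₂' u₂'')
    (δ₁ : ℝ) (hδ₁ : 0 < δ₁) (hu₁δ : ∀ x ∈ Icc (0:ℝ) 1, δ₁ ≤ u₁ x)
    (δ₂ : ℝ) (hδ₂ : 0 < δ₂) (hu₂δ : ∀ x ∈ Icc (0:ℝ) 1, δ₂ ≤ u₂ x)
    (hu₁'0 : u₁' 0 = 0) (hu₁'1 : u₁' 1 = 0) (hu₂'0 : u₂' 0 = 0) (hu₂'1 : u₂' 1 = 0)
    (heq₁ : ∀ x ∈ Icc (0:ℝ) 1, -ν * u₁'' x + (1/2) * (u₁' x)^2 = a₁ x * u₁ x)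
    (heq₂ : ∀ x ∈ Icc (0:ℝ) 1, -ν * u₂'' x + (1/2) * (u₂' x)^2 = a₂ x * u₂ x) :
    ∀ x ∈ Icc (0:ℝ) 1, u₁ x ≤ u₂ x := by
  intro x₀ hx₀
  by_contra! hlt
  obtain ⟨hd₁, hdd₁, -⟩ := hu₁
  obtain ⟨hd₂, hdd₂, -⟩ := hu₂
  have hp₁ : ∀ x ∈ Icc (0:ℝ) 1, 0 < u₁ x := fun x hx => hδ₁.trans_le (hu₁δ x hx)
  have hp₂ : ∀ x ∈ Icc (0:ℝ) 1, 0 < u₂ x := fun x hx => hδ₂.trans_le (hu₂δ x hx)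
  let z : ℝ → ℝ := fun x => Real.log (u₁ x) - Real.log (u₂ x)
  let z' : ℝ → ℝ := fun x => u₁' x / u₁ x - u₂' x / u₂ x
  let z'' : ℝ → ℝ := fun x => (u₁'' x * u₁ x - u₁' x * u₁' x) / u₁ x ^ 2 -
    (u₂'' x * u₂ x - u₂' x * u₂' x) / u₂ x ^ 2
  let c : ℝ → ℝ := fun x => (u₂ x / 2 - ν) * (u₁' x / u₁ x + u₂' x / u₂ x) / ν
  have hz : ∀ x ∈ Icc (0:ℝ) 1, HasDerivAt z (z' x) x := fun x hx =>
    ((hd₁ x hx).log (hp₁ x hx).ne').sub ((hd₂ x hx).log (hp₂ x hx).ne')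
  have hz' : ∀ x ∈ Icc (0:ℝ) 1, HasDerivAt z' (z'' x) x := fun x hx =>
    ((hdd₁ x hx).div (hd₁ x hx) (hp₁ x hx).ne').sub ((hdd₂ x hx).div (hd₂ x hx) (hp₂ x hx).ne')
  have hc : ContinuousOn c (Icc 0 1) := fun x hx =>
    (((((hd₂ x hx).continuousAt.div_const 2).sub continuousAt_const).mul
      (((hdd₁ x hx).continuousAt.div (hd₁ x hx).continuousAt (hp₁ x hx).ne').add
        ((hdd₂ x hx).continuousAt.div (hd₂ x hx).continuousAt (hp₂ x hx).ne'))).div_const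
          ν).continuousWithinAt
  have hdiff : ∀ x ∈ Icc (0:ℝ) 1, ν * (z'' x - c x * z' x) =
      (u₁ x - u₂ x) / 2 * (u₁' x / u₁ x) ^ 2 + (a₂ x - a₁ x) := by
    intro x hx
    have h₁ := (hp₁ x hx).ne'
    have h₂ := (hp₂ x hx).ne'
    have e₁ : u₁'' x = (u₁' x ^ 2 / 2 - a₁ x * u₁ x) / ν := by
      rw [eq_div_iff hν.ne']
      linarith [heq₁ x hx]
    have e₂ : u₂'' x = (u₂' x ^ 2 / 2 - a₂ x * u₂ x) / ν := by
      rw [eq_div_iff hν.ne']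
      linarith [heq₂ x hx]
    simp only [z', z'', c, e₁, e₂]
    field_simp
    ring
  have hsub : ∀ x ∈ Icc (0:ℝ) 1, 0 ≤ z x → c x * z' x ≤ z'' x := by
    intro x hx h
    have hle : u₂ x ≤ u₁ x :=
      (Real.log_le_log_iff (hp₂ x hx) (hp₁ x hx)).mp (sub_nonneg.mp h)
    have h₁ : 0 ≤ ν * (z'' x - c x * z' x) := by
      rw [hdiff x hx]
      have := sub_nonneg.mpr hle
      have := sub_nonneg.mpr (ha₁₂ x hx)
      positivity
    exact sub_nonneg.mp (nonneg_of_mul_nonneg_right h₁ hν)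
  have hmain := pos_and_deriv_eq_zero_of_neumann_subsolution zero_le_one hz hz' hc
    (by simp [z', hu₁'0, hu₂'0]) (by simp [z', hu₁'1, hu₂'1]) hsub hx₀
    (sub_pos.mpr (Real.log_lt_log (hp₂ x₀ hx₀) hlt))
  have hu₁'_zero : ∀ x ∈ Icc (0:ℝ) 1, u₁' x = 0 := by
    intro x hx
    have hgt : u₂ x < u₁ x :=
      (Real.log_lt_log_iff (hp₂ x hx) (hp₁ x hx)).mp (sub_pos.mp (hmain x hx).1)
    have h := hdiff x hx
    rw [(hmain x hx).2,
      (hz' x hx).eq_zero_of_eqOn_Icc zero_lt_one (fun y hy => (hmain y hy).2) hx] at h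
    by_contra hne
    have h₁ : 0 < (u₁' x / u₁ x) ^ 2 := by
      have := div_ne_zero hne (hp₁ x hx).ne'
      positivity
    have := mul_pos (half_pos (sub_pos.mpr hgt)) h₁
    linarith [ha₁₂ x hx]
  obtain ⟨x, hx, hax⟩ := ha₁_pos
  have h := heq₁ x hx
  rw [hu₁'_zero x hx, (hdd₁ x hx).eq_zero_of_eqOn_Icc zero_lt_one hu₁'_zero hx] at h
  have := mul_pos hax (hp₁ x hx)
  linarith
end
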